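/- Let f belong to the Hölder class 𝒞^α(𝒳,L) and define coefficients on the nodes of a dyadic chaining-tree structure of depth H by θ_{1,0} = f(x_{1,0}) and θ_{m,j} = f(x_{m,j}) − f(x_{m−1,⌊j/2⌋}) for 2 ≤ m ≤ H and j ∈ J_m (⌊j/2⌋ taken coordinatewise). Then: (a) for every x ∈ 𝒳, Σ_{m=1}^{H} Σ_{j∈J_m} θ_{m,j}·1{x ∈ 𝒳_{m,j}} = f(x_{H,j(x)}), where 𝒳_{H,j(x)} is the unique leaf cell containing x; and (b) |θ_{1,0}| ≤ B and |θ_{m,j}| ≤ L·D^α·2^{−αm} for every 2 ≤ m ≤ H and every j ∈ J_m. -/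

import Mathlib

open Finset

noncomputable section

/-- The dyadic index set at level `m`. -/
def Jset (d m : ℕ) : Finset (Fin d → ℕ) :=
  Fintype.piFinset fun _ => Finset.range (2 ^ (m - 1))

/-- Real-valued indicator of a set. -/
def indR {α : Type*} (s : Set α) (x : α) : ℝ := Set.indicator s (fun _ => (1 : ℝ)) x

/-- A dyadic chaining-tree structure of depth `H` on `X ⊆ ℝ^d` with diameter bound `D`. -/
structure DyadicTree (d : ℕ) (X : Set (Fin d → ℝ)) (D : ℝ) (H : ℕ) where
  cell : ℕ → (Fin d → ℕ) → Set (Fin d → ℝ)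
  pt : ℕ → (Fin d → ℕ) → (Fin d → ℝ)
  root_eq : cell 1 0 = X
  child_sub : ∀ m : ℕ, 1 ≤ m → m < H → ∀ j' ∈ Jset d (m + 1),
    cell (m + 1) j' ⊆ cell m (fun i => j' i / 2)
  partition : ∀ m : ℕ, 1 ≤ m → m < H → ∀ j ∈ Jset d m, ∀ x ∈ cell m j,
    ∃! j' : Fin d → ℕ,
      j' ∈ Jset d (m + 1) ∧ (∀ i, j' i / 2 = j i) ∧ x ∈ cell (m + 1) j'
  pt_dist : ∀ m ∈ Finset.Icc 1 H, ∀ j ∈ Jset d m, ∀ x ∈ cell m j,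
    ‖x - pt m j‖ ≤ (2 : ℝ) ^ (-(m : ℝ)) * D
  parent_dist : ∀ m : ℕ, 1 ≤ m → m < H → ∀ j' ∈ Jset d (m + 1),
    ‖pt (m + 1) j' - pt m (fun i => j' i / 2)‖ ≤ (2 : ℝ) ^ (-((m : ℝ) + 1)) * D

theorem half_mem_Jset {d m : ℕ} (hm : 1 ≤ m) {j : Fin d → ℕ} (hj : j ∈ Jset d (m + 1)) :
    (fun i => j i / 2) ∈ Jset d m := by
  simp only [Jset, Fintype.mem_piFinset, Finset.mem_range, Nat.add_sub_cancel] at hj ⊢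
  intro i
  obtain ⟨k, rfl⟩ := Nat.exists_eq_add_of_le' hm
  have h := hj i
  rw [pow_succ] at h
  simp only [Nat.add_sub_cancel]
  omega

theorem mem_Jset_one {d : ℕ} {j : Fin d → ℕ} : j ∈ Jset d 1 ↔ j = 0 := by
  simp [Jset, funext_iff]

namespace DyadicTree

variable {d H : ℕ} {X : Set (Fin d → ℝ)} {D : ℝ} (tree : DyadicTree d X D H)

theorem cell_subset {m : ℕ} (hm : 1 ≤ m) (hmH : m ≤ H) {j : Fin d → ℕ} (hj : j ∈ Jset d m) :
    tree.cell m j ⊆ X := by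
  induction m, hm using Nat.le_induction generalizing j with
  | base =>
    rw [mem_Jset_one.1 hj, tree.root_eq]
  | succ m hm ih =>
    exact (tree.child_sub m hm hmH j hj).trans (ih (by omega) (half_mem_Jset hm hj))

theorem index_unique {x : Fin d → ℝ} {m : ℕ} (hm : 1 ≤ m) (hmH : m ≤ H) {j k : Fin d → ℕ}
    (hj : j ∈ Jset d m) (hk : k ∈ Jset d m) (hxj : x ∈ tree.cell m j)
    (hxk : x ∈ tree.cell m k) : j = k := by
  induction m, hm using Nat.le_induction generalizing j k with
  | base =>
    rw [mem_Jset_one.1 hj, mem_Jset_one.1 hk]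
  | succ m hm ih =>
    have hxj' := tree.child_sub m hm hmH j hj hxj
    have hxk' := tree.child_sub m hm hmH k hk hxk
    have hpar := ih (by omega) (half_mem_Jset hm hj) (half_mem_Jset hm hk) hxj' hxk'
    exact (tree.partition m hm hmH _ (half_mem_Jset hm hj) x hxj').unique
      ⟨hj, fun _ => rfl, hxj⟩ ⟨hk, fun i => (congrFun hpar i).symm, hxk⟩

theorem sum_mul_indR {x : Fin d → ℝ} {m : ℕ} (hm : 1 ≤ m) (hmH : m ≤ H) {j : Fin d → ℕ}
    (hj : j ∈ Jset d m) (hxj : x ∈ tree.cell m j) (c : (Fin d → ℕ) → ℝ) :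
    ∑ k ∈ Jset d m, c k * indR (tree.cell m k) x = c j := by
  rw [Finset.sum_eq_single_of_mem j hj]
  · simp [indR, hxj]
  · intro k hk hkj
    have hxk : x ∉ tree.cell m k := fun hxk => hkj (tree.index_unique hm hmH hk hj hxk hxj)
    simp [indR, hxk]

end DyadicTree

/-- Telescoping representation and size bounds for the chaining coefficients of a
Hölder function on a dyadic chaining tree. -/
theorem stmt1
    (d H : ℕ) (hd : 1 ≤ d) (hH : 1 ≤ H)
    (X : Set (Fin d → ℝ)) (hX : X.Nonempty)
    (D L α B : ℝ) (hD : 0 ≤ D) (hL : 0 < L) (hα : 0 < α) (hα1 : α ≤ 1) (hB : 0 < B)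
    (tree : DyadicTree d X D H)
    (hpt : ∀ m ∈ Finset.Icc 1 H, ∀ j ∈ Jset d m, tree.pt m j ∈ tree.cell m j)
    (f : (Fin d → ℝ) → ℝ)
    (hHolder : ∀ y ∈ X, ∀ y' ∈ X, |f y - f y'| ≤ L * ‖y - y'‖ ^ α)
    (hbdd : ∀ y ∈ X, |f y| ≤ B)
    (θ : ℕ → (Fin d → ℕ) → ℝ)
    (hθroot : θ 1 0 = f (tree.pt 1 0))
    (hθrec : ∀ m : ℕ, 2 ≤ m → m ≤ H → ∀ j ∈ Jset d m,
      θ m j = f (tree.pt m j) - f (tree.pt (m - 1) (fun i => j i / 2))) :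
    -- (a) the multi-scale expansion equals the value at the leaf center
    (∀ x ∈ X, ∀ j ∈ Jset d H, x ∈ tree.cell H j →
      ∑ m ∈ Finset.Icc 1 H, ∑ j' ∈ Jset d m, θ m j' * indR (tree.cell m j') x
        = f (tree.pt H j)) ∧
    -- (b) bounds on the coefficients
    |θ 1 0| ≤ B ∧
    (∀ m : ℕ, 2 ≤ m → m ≤ H → ∀ j ∈ Jset d m,
      |θ m j| ≤ L * D ^ α * (2 : ℝ) ^ (-(α * (m : ℝ)))) := by
  refine ⟨fun x _ j hj hxj => ?_, ?_, fun m hm hmH j hj => ?_⟩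
  · have key : ∀ n : ℕ, 1 ≤ n → n ≤ H → ∀ k ∈ Jset d n, x ∈ tree.cell n k →
        ∑ m ∈ Finset.Icc 1 n, ∑ j' ∈ Jset d m, θ m j' * indR (tree.cell m j') x
          = f (tree.pt n k) := by
      intro n hn
      induction n, hn using Nat.le_induction with
      | base =>
        intro _ k hk hxk
        rw [Finset.Icc_self, Finset.sum_singleton, tree.sum_mul_indR le_rfl hH hk hxk,
          mem_Jset_one.1 hk, hθroot]
      | succ n hn ih =>
        intro hnH k hk hxk
        rw [Finset.sum_Icc_succ_top (by omega),
          ih (by omega) _ (half_mem_Jset hn hk) (tree.child_sub n hn hnH k hk hxk),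
          tree.sum_mul_indR (by omega) hnH hk hxk, hθrec (n + 1) (by omega) hnH k hk,
          Nat.add_sub_cancel]
        ring
    exact key H hH le_rfl j hj hxj
  · have h0 : (0 : Fin d → ℕ) ∈ Jset d 1 := mem_Jset_one.2 rfl
    rw [hθroot]
    exact hbdd _ (tree.cell_subset le_rfl hH h0 (hpt 1 (Finset.mem_Icc.2 ⟨le_rfl, hH⟩) 0 h0))
  · obtain ⟨n, rfl⟩ := Nat.exists_eq_add_of_le' (show 1 ≤ m by omega)
    have hn : 1 ≤ n := by omega
    have hj' := half_mem_Jset hn hj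
    have hchild : tree.pt (n + 1) j ∈ X := tree.cell_subset (by omega) hmH hj
      (hpt _ (Finset.mem_Icc.2 ⟨by omega, hmH⟩) j hj)
    have hparent : tree.pt n (fun i => j i / 2) ∈ X := tree.cell_subset hn (by omega) hj'
      (hpt _ (Finset.mem_Icc.2 ⟨hn, by omega⟩) _ hj')
    rw [hθrec (n + 1) hm hmH j hj, Nat.add_sub_cancel]
    calc |f (tree.pt (n + 1) j) - f (tree.pt n fun i => j i / 2)|
        ≤ L * ‖tree.pt (n + 1) j - tree.pt n fun i => j i / 2‖ ^ α :=
          hHolder _ hchild _ hparent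
      _ ≤ L * ((2 : ℝ) ^ (-((n : ℝ) + 1)) * D) ^ α := by
          have := tree.parent_dist n hn hmH j hj
          gcongr
      _ = L * D ^ α * (2 : ℝ) ^ (-(α * ((n + 1 : ℕ) : ℝ))) := by
          rw [Real.mul_rpow (by positivity) hD, ← Real.rpow_mul (by norm_num)]
          push_cast
          rw [show -((n : ℝ) + 1) * α = -(α * ((n : ℝ) + 1)) by ring]
          ring

end
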